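/- arXiv:2101.10379 — 3 statements merged into one kernel-verified Lean document; each statement's English description precedes it below -/
import Mathlib

section
/- Every 2-generated primitive axial algebra V of Monster type (2β, β) over a field F of characteristic ≠ 2 (with β ∉ {0, 1, 1/2}) is spanned as an F-vector space by the eight elements a₋₂, a₋₁, a₀, a₁, a₂, a₃, s₀,₁, s₀,₃; in particular dim_F V ≤ 8. -/
/-- The `δ`-eigenspace of the adjoint action of `a` on `V`. -/
def eigSp (F : Type*) [Field F] {V : Type*} [NonUnitalNonAssocCommRing V]
    [Module F V] [SMulCommClass F V V] [IsScalarTower F V V]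
    (a : V) (δ : F) : Submodule F V where
  carrier := {v | a * v = δ • v}
  add_mem' := by
    intro x y hx hy
    simp only [Set.mem_setOf_eq] at *
    rw [mul_add, hx, hy, smul_add]
  zero_mem' := by
    simp
  smul_mem' := by
    intro c x hx
    simp only [Set.mem_setOf_eq] at *
    rw [mul_smul_comm, hx, smul_comm]

/-- `τ` is the Miyamoto involution associated with the axis `a`:  it is the identity on the
`1`-, `0`- and `α`-eigenspaces of `ad a` and `-1` on the `β`-eigenspace. -/
def IsMiyamoto (F : Type*) [Field F] {V : Type*} [NonUnitalNonAssocCommRing V]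
    [Module F V] [SMulCommClass F V V] [IsScalarTower F V V]
    (α β : F) (a : V) (τ : V ≃ₗ[F] V) : Prop :=
  (∀ v ∈ eigSp F a 1, τ v = v) ∧ (∀ v ∈ eigSp F a 0, τ v = v) ∧
    (∀ v ∈ eigSp F a α, τ v = v) ∧ (∀ v ∈ eigSp F a β, τ v = -v)

/-- `a` is a primitive axis of Monster type `(α, β)`:  `a` is idempotent, `V` decomposes as the
sum of the eigenspaces of `ad a` for the eigenvalues `1, 0, α, β`, the fusion law
M(α, β) holds, and the `1`-eigenspace is spanned by `a` (primitivity). -/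
structure IsAxis (F : Type*) [Field F] {V : Type*} [NonUnitalNonAssocCommRing V]
    [Module F V] [SMulCommClass F V V] [IsScalarTower F V V]
    (α β : F) (a : V) : Prop where
  idem : a * a = a
  semisimple : eigSp F a 1 ⊔ eigSp F a 0 ⊔ eigSp F a α ⊔ eigSp F a β = ⊤
  primitive : eigSp F a 1 = Submodule.span F {a}
  fusion11 : ∀ u ∈ eigSp F a 1, ∀ v ∈ eigSp F a 1, u * v ∈ eigSp F a 1
  fusion10 : ∀ u ∈ eigSp F a 1, ∀ v ∈ eigSp F a 0, u * v = 0
  fusion1a : ∀ u ∈ eigSp F a 1, ∀ v ∈ eigSp F a α, u * v ∈ eigSp F a α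
  fusion1b : ∀ u ∈ eigSp F a 1, ∀ v ∈ eigSp F a β, u * v ∈ eigSp F a β
  fusion00 : ∀ u ∈ eigSp F a 0, ∀ v ∈ eigSp F a 0, u * v ∈ eigSp F a 0
  fusion0a : ∀ u ∈ eigSp F a 0, ∀ v ∈ eigSp F a α, u * v ∈ eigSp F a α
  fusion0b : ∀ u ∈ eigSp F a 0, ∀ v ∈ eigSp F a β, u * v ∈ eigSp F a β
  fusionaa : ∀ u ∈ eigSp F a α, ∀ v ∈ eigSp F a α, u * v ∈ eigSp F a 1 ⊔ eigSp F a 0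
  fusionab : ∀ u ∈ eigSp F a α, ∀ v ∈ eigSp F a β, u * v ∈ eigSp F a β
  fusionbb : ∀ u ∈ eigSp F a β, ∀ v ∈ eigSp F a β,
    u * v ∈ eigSp F a 1 ⊔ eigSp F a 0 ⊔ eigSp F a α

/-- The sequence of axes `a i` (`i ∈ ℤ`) generated from `a₀`, `a₁` by the Miyamoto
involutions:  with `σ = τ₁ ∘ τ₀`, `a (2*i) = σ^i a₀` and `a (2*i+1) = σ^i a₁`. -/
noncomputable def aSeq {F : Type*} [Field F] {V : Type*} [NonUnitalNonAssocCommRing V]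
    [Module F V] [SMulCommClass F V V] [IsScalarTower F V V]
    (a₀ a₁ : V) (τ₀ τ₁ : V ≃ₗ[F] V) (i : ℤ) : V :=
  if i % 2 = 0 then ((τ₁ * τ₀) ^ (i / 2)) a₀ else ((τ₁ * τ₀) ^ ((i - 1) / 2)) a₁

/-- `s r n = a r * a (r+n) - β • (a r + a (r+n))`. -/
noncomputable def sSeq {F : Type*} [Field F] {V : Type*} [NonUnitalNonAssocCommRing V]
    [Module F V] [SMulCommClass F V V] [IsScalarTower F V V]
    (β : F) (a₀ a₁ : V) (τ₀ τ₁ : V ≃ₗ[F] V) (r n : ℤ) : V :=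
  aSeq a₀ a₁ τ₀ τ₁ r * aSeq a₀ a₁ τ₀ τ₁ (r + n)
    - β • (aSeq a₀ a₁ τ₀ τ₁ r + aSeq a₀ a₁ τ₀ τ₁ (r + n))

section Axis
set_option linter.unusedSectionVars false

variable {F : Type*} [Field F] {V : Type*} [NonUnitalNonAssocCommRing V]
  [Module F V] [SMulCommClass F V V] [IsScalarTower F V V]

theorem mem_eigSp {a v : V} {δ : F} : v ∈ eigSp F a δ ↔ a * v = δ • v := Iff.rfl

theorem IsAxis.exists_decomp {α β : F} {a : V} (ha : IsAxis F α β a) (v : V) :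
    ∃ l : F, ∃ p ∈ eigSp F a 0, ∃ q ∈ eigSp F a α, ∃ w ∈ eigSp F a β,
      v = l • a + p + q + w := by
  have hv : v ∈ eigSp F a 1 ⊔ eigSp F a 0 ⊔ eigSp F a α ⊔ eigSp F a β := by
    rw [ha.semisimple]; trivial
  obtain ⟨y, hy, w, hw, rfl⟩ := Submodule.mem_sup.1 hv
  obtain ⟨z, hz, q, hq, rfl⟩ := Submodule.mem_sup.1 hy
  obtain ⟨t, ht, p, hp, rfl⟩ := Submodule.mem_sup.1 hz
  rw [ha.primitive] at ht
  obtain ⟨l, rfl⟩ := Submodule.mem_span_singleton.1 ht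
  exact ⟨l, p, hp, q, hq, w, hw, rfl⟩

theorem IsAxis.self_mem {α β : F} {a : V} (ha : IsAxis F α β a) : a ∈ eigSp F a (1 : F) := by
  rw [mem_eigSp, ha.idem, one_smul]

theorem IsMiyamoto.map_even {α β : F} {a : V} {T : V ≃ₗ[F] V} (hT : IsMiyamoto F α β a T)
    {v : V} (hv : v ∈ eigSp F a 1 ⊔ eigSp F a 0 ⊔ eigSp F a α) : T v = v := by
  obtain ⟨z, hz, q, hq, rfl⟩ := Submodule.mem_sup.1 hv
  obtain ⟨t, ht, p, hp, rfl⟩ := Submodule.mem_sup.1 hz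
  simp only [map_add, hT.1 t ht, hT.2.1 p hp, hT.2.2.1 q hq]

theorem IsMiyamoto.map_decomp {α β : F} {a : V} (ha : IsAxis F α β a) {T : V ≃ₗ[F] V}
    (hT : IsMiyamoto F α β a T) (l : F) {p q w : V} (hp : p ∈ eigSp F a 0)
    (hq : q ∈ eigSp F a α) (hw : w ∈ eigSp F a β) :
    T (l • a + p + q + w) = l • a + p + q - w := by
  rw [map_add, map_add, map_add, map_smul, hT.1 a ha.self_mem, hT.2.1 p hp, hT.2.2.1 q hq,
    hT.2.2.2 w hw, ← sub_eq_add_neg]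

theorem IsMiyamoto.involutive {α β : F} {a : V} (ha : IsAxis F α β a) {T : V ≃ₗ[F] V}
    (hT : IsMiyamoto F α β a T) (v : V) : T (T v) = v := by
  obtain ⟨l, p, hp, q, hq, w, hw, rfl⟩ := ha.exists_decomp v
  rw [hT.map_decomp ha l hp hq hw, sub_eq_add_neg,
    hT.map_decomp ha l hp hq ((eigSp F a β).neg_mem hw), sub_neg_eq_add]

theorem IsMiyamoto.map_mul {α β : F} {a : V} (ha : IsAxis F α β a) {T : V ≃ₗ[F] V}
    (hT : IsMiyamoto F α β a T) (x y : V) : T (x * y) = T x * T y := by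
  obtain ⟨l, p, hp, q, hq, w, hw, rfl⟩ := ha.exists_decomp x
  obtain ⟨l', p', hp', q', hq', w', hw', rfl⟩ := ha.exists_decomp y
  have hpp := hT.2.1 _ (ha.fusion00 p hp p' hp')
  have hpq := hT.2.2.1 _ (ha.fusion0a p hp q' hq')
  have hpw := hT.2.2.2 _ (ha.fusion0b p hp w' hw')
  have hqp := hT.2.2.1 _ (ha.fusion0a p' hp' q hq)
  have hqq := hT.map_even (Submodule.mem_sup_left (ha.fusionaa q hq q' hq'))
  have hqw := hT.2.2.2 _ (ha.fusionab q hq w' hw')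
  have hwp := hT.2.2.2 _ (ha.fusion0b p' hp' w hw)
  have hwq := hT.2.2.2 _ (ha.fusionab q' hq' w hw)
  have hww := hT.map_even (ha.fusionbb w hw w' hw')
  rw [mul_comm p' q] at hqp
  rw [mul_comm p' w] at hwp
  rw [mul_comm q' w] at hwq
  have ea : T a = a := hT.1 a ha.self_mem
  have ep := hT.2.1 p hp
  have eq := hT.2.2.1 q hq
  have ew := hT.2.2.2 w hw
  have ep' := hT.2.1 p' hp'
  have eq' := hT.2.2.1 q' hq'
  have ew' := hT.2.2.2 w' hw'
  have e1 : ∀ z, z * a = a * z := fun z => mul_comm z a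
  rw [mem_eigSp] at hp hq hw hp' hq' hw'
  simp only [_root_.map_add, map_smul, mul_add, add_mul, smul_mul_assoc, mul_smul_comm, ha.idem,
    e1, hp, hq, hw, hp', hq', hw', ea, ep, eq, ew, ep', eq', ew', hpp, hpq, hpw, hqp, hqq, hqw,
    hwp, hwq, hww, mul_neg, neg_mul, smul_neg]
  abel

theorem eigSp_map {e : V ≃ₗ[F] V} (he : ∀ x y, e (x * y) = e x * e y) (a : V) (δ : F) :
    eigSp F (e a) δ = (eigSp F a δ).map (e : V →ₗ[F] V) := by
  ext v
  obtain ⟨v, rfl⟩ := e.surjective v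
  simp only [mem_eigSp, Submodule.mem_map, LinearEquiv.coe_coe, ← he, ← map_smul,
    EmbeddingLike.apply_eq_iff_eq, exists_eq_right]

theorem IsAxis.map {α β : F} {a : V} (ha : IsAxis F α β a) {e : V ≃ₗ[F] V}
    (he : ∀ x y, e (x * y) = e x * e y) : IsAxis F α β (e a) := by
  constructor
  · rw [← he, ha.idem]
  · simp only [eigSp_map he, ← Submodule.map_sup, ha.semisimple, Submodule.map_top,
      LinearEquiv.range]
  · rw [eigSp_map he, ha.primitive, Submodule.map_span, Set.image_singleton]
    rfl
  all_goals
    simp only [eigSp_map he, ← Submodule.map_sup]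
    rintro _ ⟨u, hu, rfl⟩ _ ⟨v, hv, rfl⟩
    simp only [LinearEquiv.coe_coe, ← he]
  · exact Submodule.mem_map_of_mem (ha.fusion11 u hu v hv)
  · rw [ha.fusion10 u hu v hv, map_zero]
  · exact Submodule.mem_map_of_mem (ha.fusion1a u hu v hv)
  · exact Submodule.mem_map_of_mem (ha.fusion1b u hu v hv)
  · exact Submodule.mem_map_of_mem (ha.fusion00 u hu v hv)
  · exact Submodule.mem_map_of_mem (ha.fusion0a u hu v hv)
  · exact Submodule.mem_map_of_mem (ha.fusion0b u hu v hv)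
  · exact Submodule.mem_map_of_mem (ha.fusionaa u hu v hv)
  · exact Submodule.mem_map_of_mem (ha.fusionab u hu v hv)
  · exact Submodule.mem_map_of_mem (ha.fusionbb u hu v hv)

theorem IsMiyamoto.conj {α β : F} {a : V} {T : V ≃ₗ[F] V} (hT : IsMiyamoto F α β a T)
    {e : V ≃ₗ[F] V} (he : ∀ x y, e (x * y) = e x * e y) :
    IsMiyamoto F α β (e a) (e * T * e⁻¹) := by
  have key (v : V) : (e * T * e⁻¹) (e v) = e (T v) := by
    simp only [LinearEquiv.mul_apply]
    exact congrArg (fun z => e (T z)) (e.symm_apply_apply v)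
  refine ⟨?_, ?_, ?_, ?_⟩
  all_goals
    rw [eigSp_map he]
    rintro _ ⟨v, hv, rfl⟩
    simp only [LinearEquiv.coe_coe, key]
  · rw [hT.1 v hv]
  · rw [hT.2.1 v hv]
  · rw [hT.2.2.1 v hv]
  · rw [hT.2.2.2 v hv, map_neg]

/-- The element `x * y - β • (x + y)`, so that `sSeq β a₀ a₁ τ₀ τ₁ r n` is
`axSum β (a r) (a (r + n))`. -/
def axSum (β : F) (x y : V) : V := x * y - β • (x + y)

theorem axSum_comm (β : F) (x y : V) : axSum β x y = axSum β y x := by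
  rw [axSum, axSum, mul_comm, add_comm]

theorem mul_eq_axSum (β : F) (x y : V) : x * y = axSum β x y + β • (x + y) := by
  rw [axSum, sub_add_cancel]

theorem map_axSum {T : V ≃ₗ[F] V} (hT : ∀ x y, T (x * y) = T x * T y) (β : F) (x y : V) :
    T (axSum β x y) = axSum β (T x) (T y) := by
  rw [axSum, axSum, map_sub, hT, map_smul, map_add]

variable {β : F} {a : V} {T : V ≃ₗ[F] V}

/-- The `0`- and `2β`-components of `x`, up to the factor `4β`. -/
theorem IsAxis.exists_eigenvectors (ha : IsAxis F (2 * β) β a)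
    (hT : IsMiyamoto F (2 * β) β a T) (x : V) :
    ∃ m n : F, β • (x + T x) - (2 : F) • axSum β a x + m • a ∈ eigSp F a 0 ∧
      β • (x + T x) + (2 : F) • axSum β a x + n • a ∈ eigSp F a (2 * β) := by
  obtain ⟨l, p, hp, q, hq, w, hw, rfl⟩ := ha.exists_decomp x
  rw [hT.map_decomp ha l hp hq hw]
  refine ⟨-(2 * β * l - 2 * (l - β - β * l)), -(2 * β * l + 2 * (l - β - β * l)), ?_, ?_⟩
  · convert (eigSp F a 0).smul_mem (4 * β) hp using 1
    rw [mem_eigSp] at hp hq hw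
    simp only [axSum, mul_add, mul_smul_comm, ha.idem, hp, hq, hw]
    module
  · convert (eigSp F a (2 * β)).smul_mem (4 * β) hq using 1
    rw [mem_eigSp] at hp hq hw
    simp only [axSum, mul_add, mul_smul_comm, ha.idem, hp, hq, hw]
    module

theorem IsAxis.mul_sub_map (ha : IsAxis F (2 * β) β a) (hT : IsMiyamoto F (2 * β) β a T)
    (x : V) : a * x - a * T x = β • (x - T x) := by
  obtain ⟨l, p, hp, q, hq, w, hw, rfl⟩ := ha.exists_decomp x
  rw [hT.map_decomp ha l hp hq hw, ← mul_sub]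
  rw [mem_eigSp] at hw
  rw [show l • a + p + q + w - (l • a + p + q - w) = w + w by abel, mul_add, hw, smul_add]

theorem IsAxis.axSum_map (ha : IsAxis F (2 * β) β a) (hT : IsMiyamoto F (2 * β) β a T)
    (x : V) : axSum β a (T x) = axSum β a x := by
  have h := ha.mul_sub_map hT x
  rw [axSum, axSum]
  linear_combination (norm := module) -h

theorem IsAxis.mul_add_map (ha : IsAxis F (2 * β) β a) (hT : IsMiyamoto F (2 * β) β a T)
    (x : V) : a * (x + T x) = (2 : F) • axSum β a x + (2 * β) • a + β • (x + T x) := by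
  have h := ha.axSum_map hT x
  rw [mul_add, mul_eq_axSum β a x, mul_eq_axSum β a (T x), h]
  module

theorem IsAxis.exists_mul_axSum (h2 : (2 : F) ≠ 0) (ha : IsAxis F (2 * β) β a)
    (hT : IsMiyamoto F (2 * β) β a T) (x : V) :
    ∃ k : F, a * axSum β a x = β • axSum β a x + k • a + (β ^ 2 / 2) • (x + T x) := by
  obtain ⟨m, n, hm, -⟩ := ha.exists_eigenvectors hT x
  refine ⟨β ^ 2 + m / 2, ?_⟩
  rw [mem_eigSp, mul_add, mul_sub, mul_smul_comm, mul_smul_comm, mul_smul_comm,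
    ha.mul_add_map hT, ha.idem, zero_smul] at hm
  have h : (2 : F) • (a * axSum β a x) =
      (2 : F) • (β • axSum β a x + (β ^ 2 + m / 2) • a + (β ^ 2 / 2) • (x + T x)) := by
    linear_combination (norm := skip) (-1 : F) • hm
    match_scalars <;> field_simp <;> ring
  exact smul_right_injective V h2 h

/-- Comparing the squares of the `0`- and `2β`-components of `b` determines `axSum β a d`. -/
theorem IsAxis.exists_axSum_eq (h2 : (2 : F) ≠ 0) (hβ : β ≠ 0) (ha : IsAxis F (2 * β) β a)
    (hT : IsMiyamoto F (2 * β) β a T) {b d s : V} {k : F} (hs : axSum β a b = s)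
    (hb : b * s = β • s + k • b + (β ^ 2 / 2) • (a + d))
    (hc : T b * s = β • s + k • T b + (β ^ 2 / 2) • (a + T d)) :
    ∃ x y z : F, axSum β a d = (-(β / 2)) • (d + T d) + x • a + y • (b + T b) + z • s := by
  obtain ⟨m, n, hm, hn⟩ := ha.exists_eigenvectors hT b
  obtain ⟨r, hr⟩ := ha.exists_mul_axSum h2 hT b
  have hP := ha.mul_add_map hT b
  have hD := ha.mul_add_map hT d
  rw [hs] at hm hn hr hP
  have huu := ha.fusion00 _ hm _ hm
  obtain ⟨t, ht, p, hp, hvv⟩ := Submodule.mem_sup.1 (ha.fusionaa _ hn _ hn)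
  rw [ha.primitive] at ht
  obtain ⟨κ, rfl⟩ := Submodule.mem_span_singleton.1 ht
  have h8 : 8 * β ^ 3 ≠ 0 := by
    rw [show (8 : F) = 2 ^ 3 by norm_num]
    exact mul_ne_zero (pow_ne_zero 3 h2) (pow_ne_zero 3 hβ)
  set P := b + T b with hPdef
  have hPs : P * s = (2 * β) • s + k • P + (β ^ 2 / 2) • ((2 : F) • a + (d + T d)) := by
    rw [hPdef, add_mul, hb, hc]; module
  have hdiff : (β • P - (2 : F) • s + m • a) * (β • P - (2 : F) • s + m • a)
      - (β • P + (2 : F) • s + n • a) * (β • P + (2 : F) • s + n • a)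
      = (-(8 * β)) • (P * s) + (2 * β * (m - n)) • (a * P) + (-4 * (m + n)) • (a * s)
        + (m ^ 2 - n ^ 2) • a := by
    simp only [mul_add, add_mul, mul_sub, sub_mul, smul_mul_assoc, mul_smul_comm, ha.idem,
      mul_comm P a, mul_comm s a, mul_comm s P]
    module
  rw [mem_eigSp, zero_smul] at huu hp
  have h0 := congrArg (a * ·) hdiff
  simp only [mul_sub a, ← hvv] at h0
  rw [huu, hPs, hP, hr] at h0
  simp only [mul_add, mul_smul_comm, ha.idem, hp, hP, hr, hD] at h0
  have h : (8 * β ^ 3) • axSum β a d = (8 * β ^ 3) • ((-(β / 2)) • (d + T d)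
      + ((8 * β ^ 3)⁻¹ * (-(8 * β) * (2 * β * r + 2 * β * k + β ^ 2 + β ^ 3)
        + 2 * β * (m - n) * (2 * r + 2 * β + 2 * β ^ 2) - 4 * (m + n) * (β * r + r + β ^ 3)
        + m ^ 2 - n ^ 2 + κ)) • a
      + ((8 * β ^ 3)⁻¹ * (-(8 * β) * (β ^ 3 + k * β) + 4 * β ^ 3 * (m - n)
        - 4 * (m + n) * β ^ 3)) • P
      + ((8 * β ^ 3)⁻¹ * (-(8 * β) * (2 * β ^ 2 + 2 * k) + 8 * β ^ 2 * (m - n)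
        - 8 * (m + n) * β ^ 2)) • s) := by
    simp only [smul_add, smul_smul, mul_inv_cancel_left₀ h8]
    linear_combination (norm := skip) h0
    match_scalars <;> field_simp <;> ring
  exact ⟨_, _, _, smul_right_injective V h8 h⟩

/-- The fusion rules `0 ⋆ 0 = {0}` and `0 ⋆ 2β = {2β}` combined, for the `0`-component of `x`. -/
theorem IsAxis.exists_mul_zero_component (h2 : (2 : F) ≠ 0) (hβ : β ≠ 0)
    (ha : IsAxis F (2 * β) β a) (hT : IsMiyamoto F (2 * β) β a T) (x : V) :
    ∃ m : F, ∀ y, a * ((β • (x + T x) - (2 : F) • axSum β a x + m • a) * (y + T y)) =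
      (β • (x + T x) - (2 : F) • axSum β a x + m • a) *
        (β • (y + T y) + (2 : F) • axSum β a y) := by
  obtain ⟨m, -, hm, -⟩ := ha.exists_eigenvectors hT x
  refine ⟨m, fun y => ?_⟩
  obtain ⟨m', n', hm', hn'⟩ := ha.exists_eigenvectors hT y
  have h0 := ha.fusion00 _ hm _ hm'
  have h1 := ha.fusion0a _ hm _ hn'
  rw [mem_eigSp] at hm h0 h1
  set u := β • (x + T x) - (2 : F) • axSum β a x + m • a
  have hu : u * a = 0 := by rw [mul_comm, hm, zero_smul]
  have e : (2 * β) • (a * (u * (y + T y))) =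
      (2 * β) • (u * (β • (y + T y) + (2 : F) • axSum β a y)) := by
    simp only [mul_add u, mul_sub u, mul_smul_comm, hu, smul_zero, add_zero, mul_add a,
      mul_sub a, zero_smul] at h0 h1 ⊢
    linear_combination (norm := module) h0 + h1
  exact smul_right_injective V (mul_ne_zero h2 hβ) e

theorem IsAxis.axSum_mul_mem (h2 : (2 : F) ≠ 0) (hβ : β ≠ 0) (ha : IsAxis F (2 * β) β a)
    (hT : IsMiyamoto F (2 * β) β a T) {W : Submodule F V} {x y : V} (haW : a ∈ W)
    (hmul : ∀ w ∈ W, a * w ∈ W) (hx : x + T x ∈ W) (hsx : axSum β a x ∈ W)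
    (hsy : axSum β a y ∈ W) (hxs : (x + T x) * axSum β a y ∈ W)
    (hy : ∀ w ∈ W, w * (y + T y) ∈ W) : axSum β a x * axSum β a y ∈ W := by
  obtain ⟨m, hm⟩ := ha.exists_mul_zero_component h2 hβ hT x
  have e := hm y
  set u := β • (x + T x) - (2 : F) • axSum β a x + m • a with hu
  have huW : u ∈ W := W.add_mem (W.sub_mem (W.smul_mem _ hx) (W.smul_mem _ hsx))
    (W.smul_mem _ haW)
  have e' : axSum β a x * axSum β a y = (4 : F)⁻¹ • ((2 * β) • ((x + T x) * axSum β a y)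
      + (2 * m) • (a * axSum β a y) + β • (u * (y + T y)) - a * (u * (y + T y))) := by
    have h4 : (4 : F) ≠ 0 := by
      rw [show (4 : F) = 2 ^ 2 by norm_num]
      exact pow_ne_zero 2 h2
    rw [eq_inv_smul_iff₀ h4, e, mul_add u (β • _), mul_smul_comm, mul_smul_comm]
    have : u * axSum β a y = β • ((x + T x) * axSum β a y)
        - (2 : F) • (axSum β a x * axSum β a y) + m • (a * axSum β a y) := by
      rw [hu, add_mul, sub_mul, smul_mul_assoc, smul_mul_assoc, smul_mul_assoc]
    rw [this]
    module
  rw [e']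
  exact W.smul_mem _ (W.sub_mem (W.add_mem (W.add_mem (W.smul_mem _ hxs)
    (W.smul_mem _ (hmul _ hsy))) (W.smul_mem _ (hy u huW))) (hmul _ (hy u huW)))

theorem IsAxis.axSum_mul_self_sub_mem (h2 : (2 : F) ≠ 0) (hβ : β ≠ 0)
    (ha : IsAxis F (2 * β) β a) (hT : IsMiyamoto F (2 * β) β a T) {U : Submodule F V} {x t : V}
    (hxx : (x + T x) * (x + T x) ∈ U)
    (hax : a * (x + T x) ∈ U) (haax : a * (a * (x + T x)) ∈ U)
    (has : a * axSum β a x ∈ U) (haxs : a * ((x + T x) * axSum β a x) ∈ U)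
    (ht : a * ((x + T x) * (x + T x)) + β • t ∈ U) :
    axSum β a x * axSum β a x - (β ^ 2 / 4) • t ∈ U := by
  obtain ⟨m, hm⟩ := ha.exists_mul_zero_component h2 hβ hT x
  have e := hm x
  set P := x + T x
  set s := axSum β a x
  have h4 : (4 : F) ≠ 0 := by
    rw [show (4 : F) = 2 ^ 2 by norm_num]
    exact pow_ne_zero 2 h2
  have e' : s * s - (β ^ 2 / 4) • t = (4 : F)⁻¹ • (β ^ 2 • (P * P) + (2 * m) • (a * s)
      + (β * m) • (a * P) - (m • (a * (a * P))) + (2 : F) • (a * (P * s))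
      - β • (a * (P * P) + β • t)) := by
    rw [eq_inv_smul_iff₀ h4]
    simp only [add_mul, sub_mul, mul_add, mul_sub, smul_mul_assoc, mul_smul_comm,
      mul_comm s P] at e ⊢
    linear_combination (norm := skip) e
    match_scalars <;> field_simp <;> ring
  rw [e']
  refine U.smul_mem _ (U.sub_mem (U.add_mem (U.sub_mem (U.add_mem (U.add_mem ?_ ?_) ?_) ?_) ?_) ?_)
  all_goals exact U.smul_mem _ ‹_›

end Axis

section AxisSeq

set_option linter.unusedSectionVars false

variable {F : Type*} [Field F] {V : Type*} [NonUnitalNonAssocCommRing V]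
  [Module F V] [SMulCommClass F V V] [IsScalarTower F V V]

/-- A bi-infinite sequence of axes of Monster type `(2β, β)` on which the Miyamoto involutions
act as the reflections of `ℤ`. -/
structure IsAxisSeq (β : F) (a : ℤ → V) (T : ℤ → V ≃ₗ[F] V) : Prop where
  axis : ∀ i, IsAxis F (2 * β) β (a i)
  miyamoto : ∀ i, IsMiyamoto F (2 * β) β (a i) (T i)
  reflect : ∀ i j, T i (a j) = a (2 * i - j)

namespace IsAxisSeq

variable {β : F} {a : ℤ → V} {T : ℤ → V ≃ₗ[F] V}

theorem map_mul (h : IsAxisSeq β a T) (i : ℤ) (x y : V) : T i (x * y) = T i x * T i y :=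
  (h.miyamoto i).map_mul (h.axis i) x y

theorem reflect_add (h : IsAxisSeq β a T) (i n : ℤ) : T i (a (i + n)) = a (i - n) := by
  rw [h.reflect]; congr 1; ring

theorem reflect_sub (h : IsAxisSeq β a T) (i n : ℤ) : T i (a (i - n)) = a (i + n) := by
  rw [h.reflect]; congr 1; ring

theorem reflect_self (h : IsAxisSeq β a T) (i : ℤ) : T i (a i) = a i := by
  rw [h.reflect]; congr 1; ring

theorem axSum_sub (h : IsAxisSeq β a T) (i n : ℤ) :
    axSum β (a i) (a (i - n)) = axSum β (a i) (a (i + n)) := by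
  rw [← h.reflect_add, (h.axis i).axSum_map (h.miyamoto i)]

theorem axSum_succ (h : IsAxisSeq β a T) (i : ℤ) :
    axSum β (a i) (a (i + 1)) = axSum β (a 0) (a 1) := by
  have step (i : ℤ) : axSum β (a (i - 1)) (a i) = axSum β (a i) (a (i + 1)) := by
    rw [axSum_comm, h.axSum_sub]
  induction i using Int.induction_on with
  | zero => rw [zero_add]
  | succ i ih => rw [← ih, ← step (i + 1), add_sub_cancel_right]
  | pred i ih => rw [← ih, ← step (-i), sub_add_cancel]

theorem map_axSum_zero_one (h : IsAxisSeq β a T) (i : ℤ) :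
    T i (axSum β (a 0) (a 1)) = axSum β (a 0) (a 1) := by
  rw [← h.axSum_succ i, map_axSum (h.map_mul i), h.reflect_self, h.reflect_add, h.axSum_sub]

theorem exists_mul_axSum (h : IsAxisSeq β a T) (h2 : (2 : F) ≠ 0) (i : ℤ) :
    ∃ k : F, a i * axSum β (a 0) (a 1) =
      β • axSum β (a 0) (a 1) + k • a i + (β ^ 2 / 2) • (a (i + 1) + a (i - 1)) := by
  have := (h.axis i).exists_mul_axSum h2 (h.miyamoto i) (a (i + 1))
  rwa [h.reflect_add, h.axSum_succ] at this

theorem exists_axSum_two (h : IsAxisSeq β a T) (h2 : (2 : F) ≠ 0) (hβ : β ≠ 0) (i : ℤ) :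
    ∃ x y z : F, axSum β (a i) (a (i + 2)) = (-(β / 2)) • (a (i + 2) + a (i - 2)) + x • a i
      + y • (a (i + 1) + a (i - 1)) + z • axSum β (a 0) (a 1) := by
  obtain ⟨k, hk⟩ := h.exists_mul_axSum h2 (i + 1)
  rw [show i + 1 + 1 = i + 2 by ring, add_sub_cancel_right, add_comm (a (i + 2))] at hk
  have hk' := congrArg (T i) hk
  simp only [h.map_mul, map_add, map_smul, h.map_axSum_zero_one, h.reflect_self] at hk'
  have := (h.axis i).exists_axSum_eq h2 hβ (h.miyamoto i) (h.axSum_succ i) hk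
    (by rw [hk', smul_add])
  rwa [h.reflect_add, h.reflect_add] at this

theorem exists_relation (h : IsAxisSeq β a T) (h2 : (2 : F) ≠ 0) (hβ : β ≠ 0) (i : ℤ) :
    ∃ y z : F, a (i + 3) = a (i - 3) + y • (a (i + 2) - a (i - 2))
      + z • (a (i + 1) - a (i - 1)) := by
  obtain ⟨x, y, z, e⟩ := h.exists_axSum_two h2 hβ (i - 1)
  rw [show i - 1 + 2 = i + 1 by ring, show i - 1 - 2 = i - 3 by ring, sub_add_cancel,
    show i - 1 - 1 = i - 2 by ring] at e
  have hs := h.map_axSum_zero_one i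
  generalize axSum β (a 0) (a 1) = s at e hs
  have e' := congrArg (T i) e
  simp only [map_axSum (h.map_mul i), map_add, map_smul, h.reflect_add, h.reflect_sub,
    h.reflect_self, hs] at e'
  rw [axSum_comm, e] at e'
  refine ⟨2 / β * y, 2 / β * (x + β / 2), ?_⟩
  linear_combination (norm := skip) (2 / β) • e'
  match_scalars <;> field_simp <;> ring

/-- The span of six consecutive axes. -/
def sixSpan (F : Type*) [Field F] {V : Type*} [NonUnitalNonAssocCommRing V] [Module F V]
    (a : ℤ → V) (i : ℤ) : Submodule F V :=
  Submodule.span F {a (i - 2), a (i - 1), a i, a (i + 1), a (i + 2), a (i + 3)}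

theorem sixSpan_le {i : ℤ} {N : Submodule F V} (h1 : a (i - 2) ∈ N) (h2 : a (i - 1) ∈ N)
    (h3 : a i ∈ N) (h4 : a (i + 1) ∈ N) (h5 : a (i + 2) ∈ N) (h6 : a (i + 3) ∈ N) :
    sixSpan F a i ≤ N := by
  rw [sixSpan, Submodule.span_le]
  rintro _ (rfl | rfl | rfl | rfl | rfl | rfl) <;> assumption

theorem sixSpan_succ (h : IsAxisSeq β a T) (h2 : (2 : F) ≠ 0) (hβ : β ≠ 0) (i : ℤ) :
    sixSpan F a (i + 1) = sixSpan F a i := by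
  obtain ⟨y, z, e⟩ := h.exists_relation h2 hβ (i + 1)
  have mem (j : ℤ) {x : V} (hx : x ∈ ({a (j - 2), a (j - 1), a j, a (j + 1), a (j + 2),
      a (j + 3)} : Set V)) : x ∈ sixSpan F a j := Submodule.subset_span hx
  have e' : a (i + 1 - 3) = a (i + 1 + 3) - y • (a (i + 1 + 2) - a (i + 1 - 2))
      - z • (a (i + 1 + 1) - a (i + 1 - 1)) := by
    linear_combination (norm := module) -e
  apply le_antisymm
  · refine sixSpan_le ?_ ?_ ?_ ?_ ?_ ?_
    rotate_right
    · rw [e]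
      refine Submodule.add_mem _ (Submodule.add_mem _ ?_ (Submodule.smul_mem _ _
        (Submodule.sub_mem _ ?_ ?_))) (Submodule.smul_mem _ _ (Submodule.sub_mem _ ?_ ?_))
      all_goals apply mem; ring_nf; simp
    all_goals apply mem; ring_nf; simp
  · refine sixSpan_le ?_ ?_ ?_ ?_ ?_ ?_
    · rw [show i - 2 = i + 1 - 3 by ring, e']
      refine Submodule.sub_mem _ (Submodule.sub_mem _ ?_ (Submodule.smul_mem _ _
        (Submodule.sub_mem _ ?_ ?_))) (Submodule.smul_mem _ _ (Submodule.sub_mem _ ?_ ?_))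
      all_goals apply mem; ring_nf; simp
    all_goals apply mem; ring_nf; simp

theorem mem_sixSpan (h : IsAxisSeq β a T) (h2 : (2 : F) ≠ 0) (hβ : β ≠ 0) (i j : ℤ) :
    a j ∈ sixSpan F a i := by
  have key (i : ℤ) : sixSpan F a i = sixSpan F a 0 := by
    induction i using Int.induction_on with
    | zero => rfl
    | succ i ih => rw [h.sixSpan_succ h2 hβ, ih]
    | pred i ih => rw [← ih, ← h.sixSpan_succ h2 hβ (-i - 1), sub_add_cancel]
  rw [key i, ← key j]
  exact Submodule.subset_span (by simp)

/-- The span of all axes and `s_{0,1}`. -/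
def lowSpan (β : F) (a : ℤ → V) : Submodule F V :=
  Submodule.span F (insert (axSum β (a 0) (a 1)) (Set.range a))

theorem mem_lowSpan (β : F) (a : ℤ → V) (i : ℤ) : a i ∈ lowSpan β a :=
  Submodule.subset_span (Set.mem_insert_of_mem _ ⟨i, rfl⟩)

theorem axSum_mem_lowSpan (β : F) (a : ℤ → V) : axSum β (a 0) (a 1) ∈ lowSpan β a :=
  Submodule.subset_span (Set.mem_insert _ _)

theorem mul_axSum_mem_lowSpan (h : IsAxisSeq β a T) (h2 : (2 : F) ≠ 0) (i : ℤ) :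
    a i * axSum β (a 0) (a 1) ∈ lowSpan β a := by
  obtain ⟨k, hk⟩ := h.exists_mul_axSum h2 i
  rw [hk]
  have hs := axSum_mem_lowSpan β a
  have ha := mem_lowSpan β a
  exact Submodule.add_mem _ (Submodule.add_mem _ (Submodule.smul_mem _ _ hs)
    (Submodule.smul_mem _ _ (ha _))) (Submodule.smul_mem _ _ (Submodule.add_mem _ (ha _) (ha _)))

theorem mul_mem_of_axSum_mem {W : Submodule F V} {x y : V} (hx : x ∈ W) (hy : y ∈ W)
    (hs : axSum β x y ∈ W) : x * y ∈ W := by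
  rw [mul_eq_axSum β]
  exact W.add_mem hs (W.smul_mem _ (W.add_mem hx hy))

theorem axSum_two_mem_lowSpan (h : IsAxisSeq β a T) (h2 : (2 : F) ≠ 0) (hβ : β ≠ 0) (i : ℤ) :
    axSum β (a i) (a (i + 2)) ∈ lowSpan β a := by
  obtain ⟨x, y, z, e⟩ := h.exists_axSum_two h2 hβ i
  have hs := axSum_mem_lowSpan β a
  have ha := mem_lowSpan β a
  rw [e]
  exact Submodule.add_mem _ (Submodule.add_mem _ (Submodule.add_mem _
    (Submodule.smul_mem _ _ (Submodule.add_mem _ (ha _) (ha _))) (Submodule.smul_mem _ _ (ha _)))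
    (Submodule.smul_mem _ _ (Submodule.add_mem _ (ha _) (ha _)))) (Submodule.smul_mem _ _ hs)

/-- The elements whose product with `c` lies in `W`. -/
def mulComap (c : V) (W : Submodule F V) : Submodule F V := W.comap (LinearMap.mulLeft F c)

theorem mem_mulComap {c x : V} {W : Submodule F V} : x ∈ mulComap c W ↔ c * x ∈ W := Iff.rfl

theorem near_mem_mulComap (h : IsAxisSeq β a T) (h2 : (2 : F) ≠ 0) (hβ : β ≠ 0) (i : ℤ) :
    (a (i - 2) ∈ mulComap (a i) (lowSpan β a) ∧ a (i - 1) ∈ mulComap (a i) (lowSpan β a)) ∧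
      a i ∈ mulComap (a i) (lowSpan β a) ∧
      a (i + 1) ∈ mulComap (a i) (lowSpan β a) ∧ a (i + 2) ∈ mulComap (a i) (lowSpan β a) := by
  have hs := axSum_mem_lowSpan β a
  have ha := mem_lowSpan β a
  simp only [mem_mulComap]
  refine ⟨⟨?_, ?_⟩, ?_, ?_, ?_⟩
  · exact mul_mem_of_axSum_mem (ha _) (ha _)
      (by rw [h.axSum_sub]; exact h.axSum_two_mem_lowSpan h2 hβ i)
  · exact mul_mem_of_axSum_mem (ha _) (ha _) (by rwa [h.axSum_sub, h.axSum_succ])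
  · rw [(h.axis i).idem]; exact ha i
  · exact mul_mem_of_axSum_mem (ha _) (ha _) (by rwa [h.axSum_succ])
  · exact mul_mem_of_axSum_mem (ha _) (ha _) (h.axSum_two_mem_lowSpan h2 hβ i)

theorem axSum_mul_self_sub_mem (h : IsAxisSeq β a T) (h2 : (2 : F) ≠ 0) (hβ : β ≠ 0) (i : ℤ) :
    axSum β (a 0) (a 1) * axSum β (a 0) (a 1) - (β ^ 2 / 4) • axSum β (a i) (a (i + 3)) ∈
      lowSpan β a := by
  have hs := axSum_mem_lowSpan β a
  have ha := mem_lowSpan β a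
  have has := h.mul_axSum_mem_lowSpan h2
  obtain ⟨⟨m2, m1⟩, m0, p1, p2⟩ := h.near_mem_mulComap h2 hβ i
  obtain ⟨x, y, z, e⟩ := h.exists_axSum_two h2 hβ (i + 1)
  rw [← h.axSum_sub, show i + 1 - 2 = i - 1 by ring, show i + 1 + 2 = i + 3 by ring,
    add_sub_cancel_right, show i + 1 + 1 = i + 2 by ring] at e
  have hbc : a (i + 1) * a (i - 1) ∈ lowSpan β a := by
    refine mul_mem_of_axSum_mem (β := β) (ha _) (ha _) ?_
    have := h.axSum_two_mem_lowSpan h2 hβ (i - 1)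
    rwa [show i - 1 + 2 = i + 1 by ring, axSum_comm] at this
  have hax : a i * (a (i + 1) + a (i - 1)) ∈ lowSpan β a := Submodule.add_mem _ p1 m1
  have hPP : (a (i + 1) + a (i - 1)) * (a (i + 1) + a (i - 1)) =
      a (i + 1) + a (i - 1) + (2 : F) • (a (i + 1) * a (i - 1)) := by
    rw [mul_add, add_mul, add_mul, (h.axis _).idem, (h.axis _).idem, mul_comm (a (i - 1))]
    module
  have hsmem : axSum β (a 0) (a 1) ∈ mulComap (a i) (lowSpan β a) := has i
  have key := (h.axis i).axSum_mul_self_sub_mem h2 hβ (h.miyamoto i) (U := lowSpan β a)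
    (x := a (i + 1)) (t := axSum β (a i) (a (i + 3)))
  rw [h.reflect_add, h.axSum_succ] at key
  refine key ?_ hax ?_ (has i) ?_ ?_
  · rw [hPP]
    exact Submodule.add_mem _ (Submodule.add_mem _ (ha _) (ha _)) (Submodule.smul_mem _ _ hbc)
  · have e1 := (h.axis i).mul_add_map (h.miyamoto i) (a (i + 1))
    rw [h.reflect_add, h.axSum_succ] at e1
    change a i * (a (i + 1) + a (i - 1)) ∈ mulComap (a i) (lowSpan β a)
    rw [e1]
    exact Submodule.add_mem _ (Submodule.add_mem _ (Submodule.smul_mem _ _ hsmem)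
      (Submodule.smul_mem _ _ m0)) (Submodule.smul_mem _ _ (Submodule.add_mem _ p1 m1))
  · obtain ⟨k, hk⟩ := h.exists_mul_axSum h2 (i + 1)
    obtain ⟨k', hk'⟩ := h.exists_mul_axSum h2 (i - 1)
    rw [show i + 1 + 1 = i + 2 by ring, add_sub_cancel_right] at hk
    rw [show i - 1 - 1 = i - 2 by ring, sub_add_cancel] at hk'
    change (a (i + 1) + a (i - 1)) * axSum β (a 0) (a 1) ∈ mulComap (a i) (lowSpan β a)
    rw [add_mul, hk, hk']
    exact Submodule.add_mem _
      (Submodule.add_mem _ (Submodule.add_mem _ (Submodule.smul_mem _ _ hsmem)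
        (Submodule.smul_mem _ _ p1)) (Submodule.smul_mem _ _ (Submodule.add_mem _ p2 m0)))
      (Submodule.add_mem _ (Submodule.add_mem _ (Submodule.smul_mem _ _ hsmem)
        (Submodule.smul_mem _ _ m1)) (Submodule.smul_mem _ _ (Submodule.add_mem _ m0 m2)))
  · have e2 : (a (i + 1) + a (i - 1)) * (a (i + 1) + a (i - 1)) =
        (-β) • a (i + 3) + ((-β) • a (i - 1) + (2 * x) • a (i + 1)
        + (2 * y) • (a (i + 2) + a i) + (2 * z) • axSum β (a 0) (a 1)
        + (1 + 2 * β) • (a (i + 1) + a (i - 1))) := by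
      rw [hPP, mul_eq_axSum β, e]
      match_scalars <;> field_simp <;> ring
    have e3 : (-β) • a (i - 1) + (2 * x) • a (i + 1)
        + (2 * y) • (a (i + 2) + a i) + (2 * z) • axSum β (a 0) (a 1)
        + (1 + 2 * β) • (a (i + 1) + a (i - 1)) ∈ mulComap (a i) (lowSpan β a) :=
      Submodule.add_mem _ (Submodule.add_mem _ (Submodule.add_mem _ (Submodule.add_mem _
        (Submodule.smul_mem _ _ m1) (Submodule.smul_mem _ _ p1))
        (Submodule.smul_mem _ _ (Submodule.add_mem _ p2 m0))) (Submodule.smul_mem _ _ hsmem))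
        (Submodule.smul_mem _ _ (Submodule.add_mem _ p1 m1))
    rw [mem_mulComap] at e3
    have e4 := Submodule.sub_mem _ e3
      (Submodule.smul_mem _ (β ^ 2) (Submodule.add_mem _ (ha i) (ha (i + 3))))
    rw [e2, mul_add (a i) ((-β) • a (i + 3)), mul_smul_comm, mul_eq_axSum β (a i) (a (i + 3))]
    convert e4 using 1
    module

/-- The span of all axes, `s_{0,1}` and `s_{0,3}`. -/
def fullSpan (β : F) (a : ℤ → V) : Submodule F V :=
  lowSpan β a ⊔ Submodule.span F {axSum β (a 0) (a 3)}

theorem axSum_three_mem (h : IsAxisSeq β a T) (h2 : (2 : F) ≠ 0) (hβ : β ≠ 0) (i : ℤ) :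
    axSum β (a i) (a (i + 3)) - axSum β (a 0) (a 3) ∈ lowSpan β a := by
  have h0 := h.axSum_mul_self_sub_mem h2 hβ 0
  have hi := h.axSum_mul_self_sub_mem h2 hβ i
  rw [zero_add] at h0
  have h4 : (4 : F) ≠ 0 := by
    rw [show (4 : F) = 2 ^ 2 by norm_num]
    exact pow_ne_zero 2 h2
  have hd := (lowSpan β a).smul_mem (4 / β ^ 2) (Submodule.sub_mem _ h0 hi)
  convert hd using 1
  match_scalars <;> field_simp <;> ring

theorem axis_mul_mem_fullSpan (h : IsAxisSeq β a T) (h2 : (2 : F) ≠ 0) (hβ : β ≠ 0) (i : ℤ)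
    {w : V} (hw : w ∈ fullSpan β a) : a i * w ∈ fullSpan β a := by
  have hle : lowSpan β a ≤ fullSpan β a := le_sup_left
  have ha (j : ℤ) : a j ∈ fullSpan β a := hle (mem_lowSpan β a j)
  have ht : axSum β (a 0) (a 3) ∈ fullSpan β a :=
    Submodule.mem_sup_right (Submodule.mem_span_singleton_self _)
  have hti (j : ℤ) : axSum β (a j) (a (j + 3)) ∈ fullSpan β a := by
    have := Submodule.add_mem _ (hle (h.axSum_three_mem h2 hβ j)) ht
    rwa [sub_add_cancel] at this
  obtain ⟨⟨m2, m1⟩, m0, p1, p2⟩ := h.near_mem_mulComap h2 hβ i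
  have hmono : mulComap (a i) (lowSpan β a) ≤ mulComap (a i) (fullSpan β a) :=
    Submodule.comap_mono hle
  have hsix : sixSpan F a i ≤ mulComap (a i) (fullSpan β a) :=
    sixSpan_le (hmono m2) (hmono m1) (hmono m0) (hmono p1) (hmono p2)
      (mul_mem_of_axSum_mem (ha _) (ha _) (hti i))
  have hlow : lowSpan β a ≤ mulComap (a i) (fullSpan β a) := by
    rw [lowSpan, Submodule.span_le]
    rintro _ (rfl | ⟨j, rfl⟩)
    · exact hmono (h.mul_axSum_mem_lowSpan h2 i)
    · exact hsix (h.mem_sixSpan h2 hβ i j)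
  have htop : fullSpan β a ≤ mulComap (a i) (fullSpan β a) := by
    rw [fullSpan, sup_le_iff, Submodule.span_singleton_le_iff_mem]
    refine ⟨hlow, ?_⟩
    have e : a i * axSum β (a i) (a (i + 3)) ∈ fullSpan β a := by
      obtain ⟨k, hk⟩ := (h.axis i).exists_mul_axSum h2 (h.miyamoto i) (a (i + 3))
      rw [hk, h.reflect_add]
      exact Submodule.add_mem _ (Submodule.add_mem _ (Submodule.smul_mem _ _ (hti i))
        (Submodule.smul_mem _ _ (ha i))) (Submodule.smul_mem _ _ (Submodule.add_mem _ (ha _) (ha _)))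
    have e' := Submodule.sub_mem _ (mem_mulComap.2 e) (hlow (h.axSum_three_mem h2 hβ i))
    rwa [sub_sub_cancel] at e'
  exact htop hw

theorem mul_mem_fullSpan (h : IsAxisSeq β a T) (h2 : (2 : F) ≠ 0) (hβ : β ≠ 0)
    {v w : V} (hv : v ∈ fullSpan β a) (hw : w ∈ fullSpan β a) : v * w ∈ fullSpan β a := by
  have hle : lowSpan β a ≤ fullSpan β a := le_sup_left
  have ha (j : ℤ) : a j ∈ fullSpan β a := hle (mem_lowSpan β a j)
  have ht : axSum β (a 0) (a 3) ∈ fullSpan β a :=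
    Submodule.mem_sup_right (Submodule.mem_span_singleton_self _)
  have hs : axSum β (a 0) (a 1) ∈ fullSpan β a := hle (axSum_mem_lowSpan β a)
  have hmul (i : ℤ) : fullSpan β a ≤ mulComap (a i) (fullSpan β a) :=
    fun w hw => h.axis_mul_mem_fullSpan h2 hβ i hw
  have hT (j : ℤ) : T 0 (a j) = a (-j) := by rw [h.reflect, mul_zero, zero_sub]
  have key (i j : ℤ) (hi : axSum β (a 0) (a i) ∈ fullSpan β a)
      (hj : axSum β (a 0) (a j) ∈ fullSpan β a) :
      axSum β (a 0) (a i) * axSum β (a 0) (a j) ∈ fullSpan β a := by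
    refine (h.axis 0).axSum_mul_mem h2 hβ (h.miyamoto 0) (ha 0) (hmul 0) ?_ hi hj ?_ ?_
    · rw [hT]
      exact Submodule.add_mem _ (ha _) (ha _)
    · rw [hT, add_mul]
      exact Submodule.add_mem _ (hmul _ hj) (hmul _ hj)
    · intro w hw
      rw [hT, mul_comm, add_mul]
      exact Submodule.add_mem _ (hmul _ hw) (hmul _ hw)
  have left {c : V} (h1 : ∀ i, c * a i ∈ fullSpan β a)
      (h2 : c * axSum β (a 0) (a 1) ∈ fullSpan β a)
      (h3 : c * axSum β (a 0) (a 3) ∈ fullSpan β a) :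
      fullSpan β a ≤ mulComap c (fullSpan β a) := by
    conv_lhs => rw [fullSpan, lowSpan]
    rw [sup_le_iff, Submodule.span_singleton_le_iff_mem, Submodule.span_le]
    refine ⟨?_, h3⟩
    rintro _ (rfl | ⟨j, rfl⟩)
    · exact h2
    · exact h1 j
  have hs' : fullSpan β a ≤ mulComap (axSum β (a 0) (a 1)) (fullSpan β a) :=
    left (fun i => by rw [mul_comm]; exact hmul i hs) (key 1 1 hs hs) (key 1 3 hs ht)
  have ht' : fullSpan β a ≤ mulComap (axSum β (a 0) (a 3)) (fullSpan β a) :=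
    left (fun i => by rw [mul_comm]; exact hmul i ht) (key 3 1 ht hs) (key 3 3 ht ht)
  refine left (c := v) (fun i => ?_) ?_ ?_ hw
  · rw [mul_comm]; exact hmul i hv
  · rw [mul_comm]; exact hs' hv
  · rw [mul_comm]; exact ht' hv

theorem fullSpan_eq_top (h : IsAxisSeq β a T) (h2 : (2 : F) ≠ 0) (hβ : β ≠ 0)
    (hgen : NonUnitalAlgebra.adjoin F {a 0, a 1} = ⊤) : fullSpan β a = ⊤ := by
  rw [eq_top_iff]
  intro v _
  have hv : v ∈ NonUnitalAlgebra.adjoin F {a 0, a 1} := by rw [hgen]; trivial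
  have ha (j : ℤ) : a j ∈ fullSpan β a :=
    (le_sup_left : lowSpan β a ≤ fullSpan β a) (mem_lowSpan β a j)
  induction hv using NonUnitalAlgebra.adjoin_induction with
  | mem x hx =>
    rcases hx with rfl | rfl
    · exact ha 0
    · exact ha 1
  | add x y _ _ hx hy => exact Submodule.add_mem _ (hx trivial) (hy trivial)
  | zero => exact Submodule.zero_mem _
  | mul x y _ _ hx hy => exact h.mul_mem_fullSpan h2 hβ (hx trivial) (hy trivial)
  | smul r x _ hx => exact Submodule.smul_mem _ _ (hx trivial)

theorem fullSpan_le (h : IsAxisSeq β a T) (h2 : (2 : F) ≠ 0) (hβ : β ≠ 0) :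
    fullSpan β a ≤ Submodule.span F {a (-2), a (-1), a 0, a 1, a 2, a 3, axSum β (a 0) (a 1),
      axSum β (a 0) (a 3)} := by
  rw [fullSpan, lowSpan, sup_le_iff, Submodule.span_singleton_le_iff_mem, Submodule.span_le]
  refine ⟨?_, Submodule.subset_span (by simp)⟩
  rintro _ (rfl | ⟨j, rfl⟩)
  · exact Submodule.subset_span (by simp)
  · refine sixSpan_le ?_ ?_ ?_ ?_ ?_ ?_ (h.mem_sixSpan h2 hβ 0 j)
    all_goals exact Submodule.subset_span (by simp)

end IsAxisSeq

end AxisSeq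

section ASeq

set_option linter.unusedSectionVars false

variable {F : Type*} [Field F] {V : Type*} [NonUnitalNonAssocCommRing V]
  [Module F V] [SMulCommClass F V V] [IsScalarTower F V V]

theorem aSeq_even (a₀ a₁ : V) (τ₀ τ₁ : V ≃ₗ[F] V) (k : ℤ) :
    aSeq a₀ a₁ τ₀ τ₁ (2 * k) = ((τ₁ * τ₀) ^ k) a₀ := by
  rw [aSeq, if_pos (by lia), show 2 * k / 2 = k by lia]

theorem aSeq_odd (a₀ a₁ : V) (τ₀ τ₁ : V ≃ₗ[F] V) (k : ℤ) :
    aSeq a₀ a₁ τ₀ τ₁ (2 * k + 1) = ((τ₁ * τ₀) ^ k) a₁ := by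
  rw [aSeq, if_neg (by lia), show (2 * k + 1 - 1) / 2 = k by lia]

theorem aSeq_zero (a₀ a₁ : V) (τ₀ τ₁ : V ≃ₗ[F] V) : aSeq a₀ a₁ τ₀ τ₁ 0 = a₀ :=
  aSeq_even a₀ a₁ τ₀ τ₁ 0

theorem aSeq_one (a₀ a₁ : V) (τ₀ τ₁ : V ≃ₗ[F] V) : aSeq a₀ a₁ τ₀ τ₁ 1 = a₁ :=
  aSeq_odd a₀ a₁ τ₀ τ₁ 0

theorem zpow_aSeq (a₀ a₁ : V) (τ₀ τ₁ : V ≃ₗ[F] V) (k i : ℤ) :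
    ((τ₁ * τ₀) ^ k) (aSeq a₀ a₁ τ₀ τ₁ i) = aSeq a₀ a₁ τ₀ τ₁ (i + 2 * k) := by
  obtain ⟨m, rfl | rfl⟩ := Int.even_or_odd' i
  · rw [← mul_add, aSeq_even, aSeq_even, ← LinearEquiv.mul_apply, ← zpow_add, add_comm k]
  · rw [show 2 * m + 1 + 2 * k = 2 * (m + k) + 1 by ring, aSeq_odd, aSeq_odd,
      ← LinearEquiv.mul_apply, ← zpow_add, add_comm k]

theorem map_mul_zpow {e : V ≃ₗ[F] V} (he : ∀ x y, e (x * y) = e x * e y) (k : ℤ) (x y : V) :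
    (e ^ k) (x * y) = (e ^ k) x * (e ^ k) y := by
  induction k generalizing x y with
  | zero => rfl
  | succ n ih => simp only [zpow_add_one, LinearEquiv.mul_apply, he, ih]
  | pred n ih =>
    have he' (x y : V) : e⁻¹ (x * y) = e⁻¹ x * e⁻¹ y := by
      apply e.injective
      rw [he]
      simp only [← LinearEquiv.mul_apply, mul_inv_cancel, LinearEquiv.coe_one, id_eq]
    simp only [zpow_sub_one, LinearEquiv.mul_apply, he', ih]

theorem mul_zpow_mul_of_involutive {τ₀ τ₁ : V ≃ₗ[F] V} (h₀ : τ₀ * τ₀ = 1)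
    (h₁ : τ₁ * τ₁ = 1) (k : ℤ) : τ₀ * (τ₁ * τ₀) ^ k = (τ₁ * τ₀) ^ (-k) * τ₀ := by
  have hs : SemiconjBy τ₀ (τ₁ * τ₀) (τ₁ * τ₀)⁻¹ := by
    rw [SemiconjBy, mul_inv_rev, inv_eq_of_mul_eq_one_left h₀, inv_eq_of_mul_eq_one_left h₁,
      mul_assoc]
  rw [zpow_neg, ← inv_zpow]
  exact (hs.zpow_right k).eq

theorem map_aSeq_neg {a₀ a₁ : V} {τ₀ τ₁ : V ≃ₗ[F] V} (h₀ : τ₀ * τ₀ = 1)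
    (h₁ : τ₁ * τ₁ = 1) (ha₀ : τ₀ a₀ = a₀) (ha₁ : τ₁ a₁ = a₁) (i : ℤ) :
    τ₀ (aSeq a₀ a₁ τ₀ τ₁ i) = aSeq a₀ a₁ τ₀ τ₁ (-i) := by
  obtain ⟨m, rfl | rfl⟩ := Int.even_or_odd' i
  · rw [← mul_neg, aSeq_even, aSeq_even, ← LinearEquiv.mul_apply,
      mul_zpow_mul_of_involutive h₀ h₁, LinearEquiv.mul_apply, ha₀]
  · rw [show -(2 * m + 1) = 2 * (-m - 1) + 1 by ring, aSeq_odd, aSeq_odd,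
      ← LinearEquiv.mul_apply, mul_zpow_mul_of_involutive h₀ h₁, zpow_sub_one, mul_inv_rev,
      inv_eq_of_mul_eq_one_left h₀, inv_eq_of_mul_eq_one_left h₁]
    simp only [LinearEquiv.mul_apply, ha₁]

theorem map_aSeq_two_sub {a₀ a₁ : V} {τ₀ τ₁ : V ≃ₗ[F] V} (h₀ : τ₀ * τ₀ = 1)
    (h₁ : τ₁ * τ₁ = 1) (ha₀ : τ₀ a₀ = a₀) (ha₁ : τ₁ a₁ = a₁) (i : ℤ) :
    τ₁ (aSeq a₀ a₁ τ₀ τ₁ i) = aSeq a₀ a₁ τ₀ τ₁ (2 - i) := by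
  have e := zpow_aSeq a₀ a₁ τ₀ τ₁ 1 (-i)
  rw [← map_aSeq_neg h₀ h₁ ha₀ ha₁, zpow_one, ← LinearEquiv.mul_apply, mul_assoc, h₀,
    mul_one] at e
  rw [e, mul_one, neg_add_eq_sub]

theorem exists_isAxisSeq {β : F} {a₀ a₁ : V} {τ₀ τ₁ : V ≃ₗ[F] V}
    (ha₀ : IsAxis F (2 * β) β a₀) (ha₁ : IsAxis F (2 * β) β a₁)
    (hτ₀ : IsMiyamoto F (2 * β) β a₀ τ₀) (hτ₁ : IsMiyamoto F (2 * β) β a₁ τ₁) :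
    ∃ T : ℤ → V ≃ₗ[F] V, IsAxisSeq β (aSeq a₀ a₁ τ₀ τ₁) T := by
  have h₀ : τ₀ * τ₀ = 1 := LinearEquiv.ext (hτ₀.involutive ha₀)
  have h₁ : τ₁ * τ₁ = 1 := LinearEquiv.ext (hτ₁.involutive ha₁)
  have f₀ := hτ₀.1 a₀ ha₀.self_mem
  have f₁ := hτ₁.1 a₁ ha₁.self_mem
  have hm (k : ℤ) := map_mul_zpow (e := τ₁ * τ₀)
    (fun x y => by simp only [LinearEquiv.mul_apply, hτ₀.map_mul ha₀, hτ₁.map_mul ha₁]) k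
  have key (i : ℤ) : ∃ T : V ≃ₗ[F] V, IsAxis F (2 * β) β (aSeq a₀ a₁ τ₀ τ₁ i) ∧
      IsMiyamoto F (2 * β) β (aSeq a₀ a₁ τ₀ τ₁ i) T ∧
      ∀ j, T (aSeq a₀ a₁ τ₀ τ₁ j) = aSeq a₀ a₁ τ₀ τ₁ (2 * i - j) := by
    obtain ⟨m, rfl | rfl⟩ := Int.even_or_odd' i
    · rw [aSeq_even]
      refine ⟨_, ha₀.map (hm m), hτ₀.conj (hm m), fun j => ?_⟩
      rw [← zpow_neg, LinearEquiv.mul_apply, LinearEquiv.mul_apply, zpow_aSeq,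
        map_aSeq_neg h₀ h₁ f₀ f₁, zpow_aSeq]
      congr 1
      ring
    · rw [aSeq_odd]
      refine ⟨_, ha₁.map (hm m), hτ₁.conj (hm m), fun j => ?_⟩
      rw [← zpow_neg, LinearEquiv.mul_apply, LinearEquiv.mul_apply, zpow_aSeq,
        map_aSeq_two_sub h₀ h₁ f₀ f₁, zpow_aSeq]
      congr 1
      ring
  choose T hT using key
  exact ⟨T, fun i => (hT i).1, fun i => (hT i).2.1, fun i => (hT i).2.2⟩

end ASeq

/-- Every 2-generated primitive axial algebra of Monster type `(2β, β)` over a field of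
characteristic ≠ 2 is spanned by `a₋₂, a₋₁, a₀, a₁, a₂, a₃, s₀,₁, s₀,₃`;
in particular its dimension is at most `8`. -/
theorem stmt0 (F : Type*) [Field F] (V : Type*) [NonUnitalNonAssocCommRing V]
    [Module F V] [SMulCommClass F V V] [IsScalarTower F V V]
    (β : F) (hchar : (2 : F) ≠ 0) (hβ0 : β ≠ 0) (hβ1 : β ≠ 1) (hβhalf : β ≠ 1 / 2)
    (a₀ a₁ : V) (ha₀ : IsAxis F (2 * β) β a₀) (ha₁ : IsAxis F (2 * β) β a₁)
    (hgen : NonUnitalAlgebra.adjoin F {a₀, a₁} = ⊤)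
    (τ₀ τ₁ : V ≃ₗ[F] V)
    (hτ₀ : IsMiyamoto F (2 * β) β a₀ τ₀) (hτ₁ : IsMiyamoto F (2 * β) β a₁ τ₁) :
    Submodule.span F {aSeq a₀ a₁ τ₀ τ₁ (-2), aSeq a₀ a₁ τ₀ τ₁ (-1), aSeq a₀ a₁ τ₀ τ₁ 0, aSeq a₀ a₁ τ₀ τ₁ 1,
        aSeq a₀ a₁ τ₀ τ₁ 2, aSeq a₀ a₁ τ₀ τ₁ 3, sSeq β a₀ a₁ τ₀ τ₁ 0 1, sSeq β a₀ a₁ τ₀ τ₁ 0 3} = ⊤ ∧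
      Module.rank F V ≤ 8 := by
  obtain ⟨T, h⟩ := exists_isAxisSeq ha₀ ha₁ hτ₀ hτ₁
  have hspan : Submodule.span F {aSeq a₀ a₁ τ₀ τ₁ (-2), aSeq a₀ a₁ τ₀ τ₁ (-1),
      aSeq a₀ a₁ τ₀ τ₁ 0, aSeq a₀ a₁ τ₀ τ₁ 1, aSeq a₀ a₁ τ₀ τ₁ 2, aSeq a₀ a₁ τ₀ τ₁ 3,
      sSeq β a₀ a₁ τ₀ τ₁ 0 1, sSeq β a₀ a₁ τ₀ τ₁ 0 3} = ⊤ := by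
    rw [eq_top_iff, ← h.fullSpan_eq_top hchar hβ0 (by rwa [aSeq_zero, aSeq_one])]
    exact h.fullSpan_le hchar hβ0
  refine ⟨hspan, ?_⟩
  rw [← rank_top, ← hspan, show (8 : Cardinal) = 1 + 1 + 1 + 1 + 1 + 1 + 1 + 1 by norm_num]
  refine (rank_span_le _).trans ?_
  iterate 7 refine Cardinal.mk_insert_le.trans (add_le_add ?_ le_rfl)
  exact (Cardinal.mk_singleton _).le
end

section
/- Let V be a 2-generated primitive axial algebra of Monster type (2β, β) over a field F of characteristic ≠ 2 (β ∉ {0, 1, 1/2}) with generating axes a₀, a₁. Then s₀,₂ = −(β/2)(a₋₂ + a₂) + β·Z(λ₁, λ₁ᶠ)·(a₁ + a₋₁) − [2·Z(λ₁, λ₁ᶠ)·(λ₁ − β) − (λ₂ − β)]·a₀ + 2·Z(λ₁, λ₁ᶠ)·s₀,₁. -/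
/-- The polynomial `Z(x, y) = (2/β) x + ((2β-1)/β²) y - (4β-1)/β`. -/
noncomputable def zPoly {F : Type*} [Field F] (β x y : F) : F :=
  2 / β * x + (2 * β - 1) / β ^ 2 * y - (4 * β - 1) / β

section AxisDecomposition

variable {F : Type*} [Field F] {V : Type*} [NonUnitalNonAssocCommRing V]
  [Module F V] [SMulCommClass F V V] [IsScalarTower F V V]

theorem IsAxis.mem_eigSp_one {α β : F} {a : V} (ha : IsAxis F α β a) : a ∈ eigSp F a 1 := by
  rw [mem_eigSp, ha.idem, one_smul]

/-- The eigenvector decomposition of `b` with respect to the axis `a`, with the image of `b`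
under the Miyamoto involution. -/
theorem IsAxis.exists_decomposition {α β : F} {a b : V} {τ : V ≃ₗ[F] V} {l : F}
    (ha : IsAxis F α β a) (hτ : IsMiyamoto F α β a τ)
    (h : b - l • a ∈ eigSp F a 0 ⊔ eigSp F a α ⊔ eigSp F a β) :
    ∃ u ∈ eigSp F a 0, ∃ v ∈ eigSp F a α, ∃ w ∈ eigSp F a β,
      b = l • a + u + v + w ∧ τ b = l • a + u + v - w := by
  obtain ⟨x, hx, w, hw, hxw⟩ := Submodule.mem_sup.1 h
  obtain ⟨u, hu, v, hv, huv⟩ := Submodule.mem_sup.1 hx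
  have hb : b = l • a + u + v + w := by
    rw [← huv] at hxw
    rw [add_assoc, add_assoc, ← add_assoc u, hxw, add_sub_cancel]
  refine ⟨u, hu, v, hv, w, hw, hb, ?_⟩
  rw [hb, map_add, map_add, map_add, map_smul, hτ.1 a ha.mem_eigSp_one, hτ.2.1 u hu,
    hτ.2.2.1 v hv, hτ.2.2.2 w hw, sub_eq_add_neg]

/-- The Miyamoto involution sends `b` to its conjugate and back. -/
theorem IsAxis.miyamoto_miyamoto {α β : F} {a b : V} {τ : V ≃ₗ[F] V} {l : F}
    (ha : IsAxis F α β a) (hτ : IsMiyamoto F α β a τ)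
    (h : b - l • a ∈ eigSp F a 0 ⊔ eigSp F a α ⊔ eigSp F a β) : τ (τ b) = b := by
  obtain ⟨u, hu, v, hv, w, hw, hb, hτb⟩ := ha.exists_decomposition hτ h
  rw [hτb, map_sub, map_add, map_add, map_smul, hτ.1 a ha.mem_eigSp_one, hτ.2.1 u hu,
    hτ.2.2.1 v hv, hτ.2.2.2 w hw, sub_neg_eq_add, ← hb]

/-- In Monster type `(2β, β)`, the vector `a * b - β • (a + b)` has no `β`-component. -/
theorem mul_sub_smul_add_eq {β l : F} {a b u v w : V} (ha : a * a = a)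
    (hu : u ∈ eigSp F a 0) (hv : v ∈ eigSp F a (2 * β)) (hw : w ∈ eigSp F a β)
    (hb : b = l • a + u + v + w) :
    a * b - β • (a + b) = (l - β - β * l) • a - β • u + β • v := by
  rw [mem_eigSp] at hu hv hw
  rw [hb]
  simp only [mul_add, mul_smul_comm, ha, hu, hv, hw]
  module

/-- The product of the axis `a` with `a * b - β • (a + b)`, in terms of `b` and its image
under the Miyamoto involution of `a`. -/
theorem IsAxis.two_smul_mul_eq {β l : F} {a b : V} {τ : V ≃ₗ[F] V}
    (ha : IsAxis F (2 * β) β a) (hτ : IsMiyamoto F (2 * β) β a τ)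
    (h : b - l • a ∈ eigSp F a 0 ⊔ eigSp F a (2 * β) ⊔ eigSp F a β) :
    (2 : F) • (a * (a * b - β • (a + b))) =
      (2 * (l - β - β * l) * (1 - β) - 2 * β ^ 2 * l) • a + β ^ 2 • (b + τ b)
        + (2 * β) • (a * b - β • (a + b)) := by
  obtain ⟨u, hu, v, hv, w, hw, hb, hτb⟩ := ha.exists_decomposition hτ h
  rw [mul_sub_smul_add_eq ha.idem hu hv hw hb, hτb, hb]
  rw [mem_eigSp] at hu hv
  simp only [mul_add, mul_sub, mul_smul_comm, ha.idem, hu, hv]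
  module

/-- The Miyamoto involution is multiplicative on a product whose second factor has no
`β`-component. -/
theorem IsAxis.miyamoto_mul {α β l c d e : F} {a u v w : V} {τ : V ≃ₗ[F] V}
    (ha : IsAxis F α β a) (hτ : IsMiyamoto F α β a τ)
    (hu : u ∈ eigSp F a 0) (hv : v ∈ eigSp F a α) (hw : w ∈ eigSp F a β) :
    τ ((l • a + u + v + w) * (c • a + d • u + e • v)) =
      (l • a + u + v - w) * (c • a + d • u + e • v) := by
  have hvv : τ (v * v) = v * v := by
    obtain ⟨x, hx, y, hy, hxy⟩ := Submodule.mem_sup.1 (ha.fusionaa v hv v hv)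
    rw [← hxy, map_add, hτ.1 x hx, hτ.2.1 y hy]
  have haa := hτ.1 a ha.mem_eigSp_one
  have huu := hτ.2.1 _ (ha.fusion00 u hu u hu)
  have huv := hτ.2.2.1 _ (ha.fusion0a u hu v hv)
  have hwu := hτ.2.2.2 _ (ha.fusion0b u hu w hw)
  have hwv := hτ.2.2.2 _ (ha.fusionab v hv w hw)
  have hτv := hτ.2.2.1 v hv
  have hτw := hτ.2.2.2 w hw
  rw [mem_eigSp] at hu hv hw
  simp only [mul_add, add_mul, sub_mul, mul_smul_comm, smul_mul_assoc, mul_comm u a,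
    mul_comm v a, mul_comm w a, mul_comm v u, mul_comm w u, mul_comm w v, ha.idem, hu, hv, hw,
    map_add, map_smul, haa, huu, huv, hvv, hwu, hwv, hτv, hτw]
  module

end AxisDecomposition

/-- The formula for `s₀,₂` in a 2-generated primitive axial algebra of Monster type
`(2β, β)`. -/
theorem stmt6 (F : Type*) [Field F] (V : Type*) [NonUnitalNonAssocCommRing V]
    [Module F V] [SMulCommClass F V V] [IsScalarTower F V V]
    (β : F) (hchar : (2 : F) ≠ 0) (hβ0 : β ≠ 0) (hβ1 : β ≠ 1) (hβhalf : β ≠ 1 / 2)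
    (a₀ a₁ : V) (ha₀ : IsAxis F (2 * β) β a₀) (ha₁ : IsAxis F (2 * β) β a₁)
    (hgen : NonUnitalAlgebra.adjoin F {a₀, a₁} = ⊤)
    (τ₀ τ₁ : V ≃ₗ[F] V)
    (hτ₀ : IsMiyamoto F (2 * β) β a₀ τ₀) (hτ₁ : IsMiyamoto F (2 * β) β a₁ τ₁)
    (l1 l1f l2 : F)
    (hl1 : aSeq a₀ a₁ τ₀ τ₁ 1 - l1 • a₀ ∈
      eigSp F a₀ 0 ⊔ eigSp F a₀ (2 * β) ⊔ eigSp F a₀ β)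
    (hl1f : aSeq a₀ a₁ τ₀ τ₁ 0 - l1f • a₁ ∈
      eigSp F a₁ 0 ⊔ eigSp F a₁ (2 * β) ⊔ eigSp F a₁ β)
    (hl2 : aSeq a₀ a₁ τ₀ τ₁ 2 - l2 • a₀ ∈
      eigSp F a₀ 0 ⊔ eigSp F a₀ (2 * β) ⊔ eigSp F a₀ β) :
    sSeq β a₀ a₁ τ₀ τ₁ 0 2 =
      -(β / 2) • (aSeq a₀ a₁ τ₀ τ₁ (-2) + aSeq a₀ a₁ τ₀ τ₁ 2)
        + (β * zPoly β l1 l1f) • (aSeq a₀ a₁ τ₀ τ₁ 1 + aSeq a₀ a₁ τ₀ τ₁ (-1))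
        - (2 * zPoly β l1 l1f * (l1 - β) - (l2 - β)) • aSeq a₀ a₁ τ₀ τ₁ 0
        + (2 * zPoly β l1 l1f) • sSeq β a₀ a₁ τ₀ τ₁ 0 1 := by
  have e0 : aSeq a₀ a₁ τ₀ τ₁ 0 = a₀ := by simp [aSeq]
  have e1 : aSeq a₀ a₁ τ₀ τ₁ 1 = a₁ := by simp [aSeq]
  have h0 := hτ₀.1 a₀ ha₀.mem_eigSp_one
  have h1 := hτ₁.1 a₁ ha₁.mem_eigSp_one
  have e2 : aSeq a₀ a₁ τ₀ τ₁ 2 = τ₁ a₀ := by simp [aSeq, h0]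
  rw [e0] at hl1f
  rw [e1] at hl1
  rw [e2] at hl2
  have em1 : aSeq a₀ a₁ τ₀ τ₁ (-1) = τ₀ a₁ := by
    have : (τ₁ * τ₀) (τ₀ a₁) = a₁ := by
      rw [LinearEquiv.mul_apply, ha₀.miyamoto_miyamoto hτ₀ hl1, h1]
    have h : aSeq a₀ a₁ τ₀ τ₁ (-1) = (τ₁ * τ₀)⁻¹ a₁ := by simp [aSeq]
    rw [h]
    exact (LinearEquiv.symm_apply_eq _).2 this.symm
  have em2 : aSeq a₀ a₁ τ₀ τ₁ (-2) = τ₀ (τ₁ a₀) := by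
    have : (τ₁ * τ₀) (τ₀ (τ₁ a₀)) = a₀ := by
      rw [LinearEquiv.mul_apply, ha₀.miyamoto_miyamoto hτ₀ hl2,
        ha₁.miyamoto_miyamoto hτ₁ hl1f]
    have h : aSeq a₀ a₁ τ₀ τ₁ (-2) = (τ₁ * τ₀)⁻¹ a₀ := by simp [aSeq]
    rw [h]
    exact (LinearEquiv.symm_apply_eq _).2 this.symm
  have hs := ha₁.two_smul_mul_eq hτ₁ hl1f
  obtain ⟨u, hu, v, hv, w, hw, ha1, hτa1⟩ := ha₀.exists_decomposition hτ₀ hl1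
  obtain ⟨x, hx, y, hy, z, hz, ha2, hτa2⟩ := ha₀.exists_decomposition hτ₀ hl2
  have hS := mul_sub_smul_add_eq ha₀.idem hu hv hw ha1
  have hS2 := mul_sub_smul_add_eq ha₀.idem hx hy hz ha2
  rw [mul_comm a₁ a₀, add_comm a₁ a₀] at hs
  have hSe : (l1 - β - β * l1) • a₀ - β • u + β • v =
      (l1 - β - β * l1) • a₀ + (-β) • u + β • v := by module
  have hm := ha₀.miyamoto_mul (l := l1) (c := l1 - β - β * l1) (d := -β) (e := β)
    hτ₀ hu hv hw
  rw [← hSe, ← hS, ← ha1, ← hτa1] at hm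
  have hτS : τ₀ (a₀ * a₁ - β • (a₀ + a₁)) = a₀ * a₁ - β • (a₀ + a₁) := by
    rw [hS, map_add, map_sub, map_smul, map_smul, map_smul, h0, hτ₀.2.1 u hu,
      hτ₀.2.2.1 v hv]
  have hs_conj := congrArg τ₀ hs
  rw [map_smul, hm, map_add, map_add, map_smul, map_smul, map_smul, map_add, hτS, h0] at hs_conj
  obtain ⟨p, hp, q, hq, hpq⟩ := Submodule.mem_sup.1 (ha₀.fusionaa v hv v hv)
  rw [ha₀.primitive] at hp
  obtain ⟨t, rfl⟩ := Submodule.mem_span_singleton.1 hp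
  have huu := ha₀.fusion00 u hu u hu
  have hid := ha₀.idem
  simp only [sSeq, zero_add, e0, e1, e2, em1, em2]
  rw [hS2, hS, hτa2, ha2, hτa1]
  rw [hS, hτa1, hτa2] at hs_conj
  rw [hS, ha2] at hs
  rw [ha1] at hs ⊢
  rw [mem_eigSp] at hu hv hx hy hq huu
  set c := l1 - β - β * l1 with hc
  set k := 2 * (l1f - β - β * l1f) * (1 - β) - 2 * β ^ 2 * l1f with hk
  have key : (4 * l1 * c + 4 * β * t - 2 * l1 * k - 2 * β ^ 2 * (1 + l2) - 4 * β * c) • a₀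
      + (4 * β) • (q - u * u) + (4 * β ^ 2 - 2 * k) • u
      + (8 * β ^ 2 * l1 + 8 * β * c - 2 * k - 4 * β ^ 2) • v
      - (2 * β ^ 2) • (x + y) = 0 := by
    have hsum := congrArg₂ (· + ·) hs hs_conj
    simp only [mul_add, add_mul, sub_mul, mul_sub, mul_smul_comm, smul_mul_assoc, mul_comm u a₀,
      mul_comm v a₀, mul_comm v u, mul_comm w u, mul_comm w v, mul_comm w a₀, hid, hu, hv,
      ← hpq] at hsum
    linear_combination (norm := module) hsum
  generalize 4 * l1 * c + 4 * β * t - 2 * l1 * k - 2 * β ^ 2 * (1 + l2) - 4 * β * c = A at key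
  have key1 := congrArg (a₀ * ·) key
  simp only [mul_add, mul_sub, mul_smul_comm, hid, hu, hv, hx, hy, hq, huu, mul_zero] at key1
  have key2 := congrArg (a₀ * ·) key1
  simp only [mul_add, mul_sub, mul_smul_comm, hid, hv, hy, mul_zero,
    zero_smul, smul_zero, add_zero, sub_zero, zero_add] at key1 key2
  have hβ2 : 1 - 2 * β ≠ 0 := by
    intro h
    apply hβhalf
    field_simp
    linear_combination -h
  have hA : A • a₀ = 0 := by
    have : (1 - 2 * β) • (A • a₀) = 0 := by
      linear_combination (norm := module) key2 - (2 * β) • key1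
    exact (smul_eq_zero.1 this).resolve_left hβ2
  have hZ : 8 * β ^ 2 * l1 + 8 * β * c - 2 * k - 4 * β ^ 2 = 4 * β ^ 2 * zPoly β l1 l1f := by
    rw [hc, hk, zPoly]
    field_simp
    ring
  rw [hZ] at key1
  have hyv : y = (2 * zPoly β l1 l1f) • v := by
    have h4 : (4 * β ^ 3) • (y - (2 * zPoly β l1 l1f) • v) = 0 := by
      linear_combination (norm := module) hA - key1
    have h4ne : 4 * β ^ 3 ≠ 0 := by
      rw [show (4 : F) = 2 * 2 by norm_num]
      exact mul_ne_zero (mul_ne_zero hchar hchar) (pow_ne_zero 3 hβ0)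
    exact sub_eq_zero.1 ((smul_eq_zero.1 h4).resolve_left h4ne)
  generalize zPoly β l1 l1f = Z at hyv
  rw [hyv, hc]
  match_scalars <;> field_simp <;> ring
end

section
/- Let a be an axis of V and let b ∈ V. Then the element a·b − β(a + b) is fixed by the Miyamoto map τ_a, i.e. τ_a(a·b − β(a + b)) = a·b − β(a + b). In particular, if a and b are both axes, then a·b − β(a + b) is fixed by both τ_a and τ_b. -/
/-- The Miyamoto map of `a` fixes `a * v - β • v` for every `v`. -/
theorem IsMiyamoto.apply_mul_sub_smul {F : Type*} [Field F] {V : Type*}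
    [NonUnitalNonAssocCommRing V] [Module F V] [SMulCommClass F V V] [IsScalarTower F V V]
    {α β : F} {a : V} {τ : V ≃ₗ[F] V} (hτ : IsMiyamoto F α β a τ)
    (hass : eigSp F a 1 ⊔ eigSp F a 0 ⊔ eigSp F a α ⊔ eigSp F a β = ⊤) (v : V) :
    τ (a * v - β • v) = a * v - β • v := by
  obtain ⟨h1, h0, hα, -⟩ := hτ
  have fixed {δ : F} (h : ∀ w ∈ eigSp F a δ, τ w = w) {w : V} (hw : w ∈ eigSp F a δ) :
      τ (a * w - β • w) = a * w - β • w := by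
    have hmul : a * w = δ • w := hw
    rw [hmul, map_sub, map_smul, map_smul, h w hw]
  have hv : v ∈ eigSp F a 1 ⊔ eigSp F a 0 ⊔ eigSp F a α ⊔ eigSp F a β :=
    hass ▸ Submodule.mem_top
  obtain ⟨p, hp, z, hz, rfl⟩ := Submodule.mem_sup.1 hv
  obtain ⟨q, hq, y, hy, rfl⟩ := Submodule.mem_sup.1 hp
  obtain ⟨x, hx, w, hw, rfl⟩ := Submodule.mem_sup.1 hq
  have hz0 : a * z - β • z = 0 := sub_eq_zero.2 hz
  have key : a * (x + w + y + z) - β • (x + w + y + z) =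
      (a * x - β • x) + (a * w - β • w) + (a * y - β • y) := by
    rw [← add_zero ((a * x - β • x) + (a * w - β • w) + (a * y - β • y)), ← hz0]
    simp only [mul_add, smul_add]
    abel
  rw [key, map_add, map_add, fixed h1 hx, fixed h0 hw, fixed hα hy]

/-- The Miyamoto map of an idempotent `a` fixes `a * v - β • (a + v)` for every `v`. -/
theorem IsMiyamoto.apply_mul_sub_smul_add {F : Type*} [Field F] {V : Type*}
    [NonUnitalNonAssocCommRing V] [Module F V] [SMulCommClass F V V] [IsScalarTower F V V]
    {α β : F} {a : V} {τ : V ≃ₗ[F] V} (hτ : IsMiyamoto F α β a τ) (ha : a * a = a)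
    (hass : eigSp F a 1 ⊔ eigSp F a 0 ⊔ eigSp F a α ⊔ eigSp F a β = ⊤) (v : V) :
    τ (a * v - β • (a + v)) = a * v - β • (a + v) := by
  have hmem : a * a = (1 : F) • a := by rw [ha, one_smul]
  have split : a * v - β • (a + v) = (a * v - β • v) - β • a := by
    rw [smul_add]
    abel
  rw [split, map_sub, map_smul, hτ.apply_mul_sub_smul hass, hτ.1 a hmem]

/-- For an axis `a` and any `b ∈ V`, the element `a*b - β(a + b)` is fixed by the Miyamoto
map `τ_a`;  in particular if `b` is also an axis it is fixed by both `τ_a` and `τ_b`. -/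
theorem stmt8 (F : Type*) [Field F] (V : Type*) [NonUnitalNonAssocCommRing V]
    [Module F V] [SMulCommClass F V V] [IsScalarTower F V V]
    (α β : F) (hα0 : α ≠ 0) (hα1 : α ≠ 1) (hβ0 : β ≠ 0) (hβ1 : β ≠ 1) (hαβ : α ≠ β)
    (a b : V) (ha : a * a = a)
    (hass : eigSp F a 1 ⊔ eigSp F a 0 ⊔ eigSp F a α ⊔ eigSp F a β = ⊤)
    (τa : V ≃ₗ[F] V) (hτa : IsMiyamoto F α β a τa) :
    τa (a * b - β • (a + b)) = a * b - β • (a + b) ∧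
      (b * b = b →
        eigSp F b 1 ⊔ eigSp F b 0 ⊔ eigSp F b α ⊔ eigSp F b β = ⊤ →
        ∀ τb : V ≃ₗ[F] V, IsMiyamoto F α β b τb →
          τb (a * b - β • (a + b)) = a * b - β • (a + b)) := by
  refine ⟨hτa.apply_mul_sub_smul_add ha hass b, fun hb hbss τb hτb => ?_⟩
  rw [mul_comm a b, add_comm a b]
  exact hτb.apply_mul_sub_smul_add hb hbss a
end
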